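/- Suppose T_1, T_2 are words and 1 ≤ i ≤ n−2 are such that R_1 = T_1·i(i+1)i·T_2 and R_2 = T_1·(i+1)i(i+1)·T_2 are both reduced words for the longest element w_0 ∈ S_n. Let u = w(T_1), a = u(i), b = u(i+1), c = u(i+2), v_1 = Dem(T_1·i·T_2), v_2 = Dem(T_1·(i+1)·T_2). Then a < b < c, Supp(v_1) = Supp(v_2) = {a, a+1, …, c}, and moreover: Fwd(v_1) = {u(j) : j ≤ i+1, u(j) ∈ [a,c]} ⊇ {a,b}; Bwd(v_1) = {u(j) : j ≥ i+2, u(j) ∈ [a,c]} ⊇ {c}; Fwd(v_2) = {u(j) : j ≤ i, u(j) ∈ [a,c]} ⊇ {a}; Bwd(v_2) = {u(j) : j ≥ i+1, u(j) ∈ [a,c]} ⊇ {b,c}. -/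

import Mathlib

open scoped Classical

namespace BSDist

/-- The simple transposition `s i` (1-indexed): it swaps the values `i` and `i+1`
of `{1,…,n}`, i.e. the elements `i-1` and `i` of `Fin n`.  Out-of-range letters
give the identity. -/
def sTr (n : ℕ) (i : ℕ) : Equiv.Perm (Fin n) :=
  if h : 1 ≤ i ∧ i < n then Equiv.swap ⟨i - 1, by omega⟩ ⟨i, h.2⟩ else 1

/-- The product `w(R) = s_{i₁} ⋯ s_{i_L}` of a word. -/
def wprod (n : ℕ) (R : List ℕ) : Equiv.Perm (Fin n) := (R.map (sTr n)).prod

/-- The Coxeter length of a permutation: its number of inversions. -/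
def len {n : ℕ} (w : Equiv.Perm (Fin n)) : ℕ :=
  (Finset.univ.filter (fun p : Fin n × Fin n => p.1 < p.2 ∧ w p.2 < w p.1)).card

/-- A word over the alphabet `{1,…,n-1}`. -/
def Alphabet (n : ℕ) (R : List ℕ) : Prop := ∀ i ∈ R, 1 ≤ i ∧ i < n

/-- `R` is a reduced word (over the alphabet `{1,…,n-1}`). -/
def IsReducedWord (n : ℕ) (R : List ℕ) : Prop :=
  Alphabet n R ∧ R.length = len (wprod n R)

/-- `R` is a reduced word for `w`. -/
def IsReducedWordFor (n : ℕ) (R : List ℕ) (w : Equiv.Perm (Fin n)) : Prop :=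
  IsReducedWord n R ∧ wprod n R = w

/-- The weight `wt_R : S_n → ℤ[q]`, defined by the recursion
`wt_∅(e) = 1`, `wt_∅(x) = 0` for `x ≠ e`, and for an appended letter `i`:
`wt_{Ri}(x) = wt_R(x) + wt_R(x sᵢ)` if `ℓ(x sᵢ) > ℓ(x)`, and
`wt_{Ri}(x) = q·wt_R(x) + q·wt_R(x sᵢ)` if `ℓ(x sᵢ) < ℓ(x)`. -/
noncomputable def wt (n : ℕ) (R : List ℕ) : Equiv.Perm (Fin n) → Polynomial ℤ :=
  R.foldl
    (fun f i x =>
      if len x < len (x * sTr n i) then f x + f (x * sTr n i)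
      else Polynomial.X * f x + Polynomial.X * f (x * sTr n i))
    (fun x => if x = 1 then 1 else 0)

/-- A single commutation move: replace a consecutive factor `ij` by `ji` where
`|i - j| > 1`. -/
def CommMove (R R' : List ℕ) : Prop :=
  ∃ (A B : List ℕ) (i j : ℕ), (i + 1 < j ∨ j + 1 < i) ∧
    R = A ++ [i, j] ++ B ∧ R' = A ++ [j, i] ++ B

/-- Commutation equivalence: a finite sequence of commutation moves. -/
def CommEquiv (R R' : List ℕ) : Prop := Relation.ReflTransGen CommMove R R'

/-- A single braid move: replace a consecutive factor `k(k+1)k` by `(k+1)k(k+1)`. -/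
def BraidMove (R R' : List ℕ) : Prop :=
  ∃ (A B : List ℕ) (k : ℕ),
    R = A ++ [k, k + 1, k] ++ B ∧ R' = A ++ [k + 1, k, k + 1] ++ B

/-- The Demazure product of a word, computed left to right:
`w ∗ sᵢ = w sᵢ` if `ℓ(w sᵢ) > ℓ(w)`, and `w ∗ sᵢ = w` otherwise. -/
def dem (n : ℕ) (R : List ℕ) : Equiv.Perm (Fin n) :=
  R.foldl (fun w i => if len w < len (w * sTr n i) then w * sTr n i else w) 1

/-- `app w t` is the value `w(t)` in 1-indexed one-line notation:
positions and values both run through `{1,…,n}`. -/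
def app {n : ℕ} (w : Equiv.Perm (Fin n)) (t : ℕ) : ℕ :=
  if h : 1 ≤ t ∧ t ≤ n then ((w ⟨t - 1, by omega⟩ : Fin n) : ℕ) + 1 else 0

/-- `posOf x t = x⁻¹(t)`, the (1-indexed) position of the value `t` in `x`. -/
def posOf {n : ℕ} (x : Equiv.Perm (Fin n)) (t : ℕ) : ℕ := app x⁻¹ t

/-- The longest element `w₀` of `S_n` (the order-reversing permutation). -/
def w0 (n : ℕ) : Equiv.Perm (Fin n) := ⟨Fin.rev, Fin.rev, Fin.rev_rev, Fin.rev_rev⟩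

/-- The value pair `(a,b)` (with `a < b`) is an inversion of `x`:
`x⁻¹(a) > x⁻¹(b)`. -/
def IsInversion {n : ℕ} (x : Equiv.Perm (Fin n)) (a b : ℕ) : Prop :=
  posOf x b < posOf x a

/-- `tau R a b` is the first time `k` at which the pair `(a,b)` is an inversion
of the prefix product `s_{i₁} ⋯ s_{i_k}`. -/
noncomputable def tau (n : ℕ) (R : List ℕ) (a b : ℕ) : ℕ :=
  sInf {k | IsInversion (wprod n (R.take k)) a b}

/-- `T_R(a,b,c) = +1` if `τ_R(a,b) < τ_R(b,c)` and `-1` otherwise. -/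
noncomputable def T (n : ℕ) (R : List ℕ) (a b c : ℕ) : ℤ :=
  if tau n R a b < tau n R b c then 1 else -1

/-- `Supp(x) = {t : pos_x(t) ≠ pos_{w₀}(t)}`. -/
noncomputable def Supp (n : ℕ) (x : Equiv.Perm (Fin n)) : Finset ℕ :=
  (Finset.Icc 1 n).filter (fun t => posOf x t ≠ posOf (w0 n) t)

/-- `Fwd(x) = {t : pos_x(t) < pos_{w₀}(t)}`. -/
noncomputable def Fwd (n : ℕ) (x : Equiv.Perm (Fin n)) : Finset ℕ :=
  (Finset.Icc 1 n).filter (fun t => posOf x t < posOf (w0 n) t)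

/-- `Bwd(x) = {t : pos_x(t) > pos_{w₀}(t)}`. -/
noncomputable def Bwd (n : ℕ) (x : Equiv.Perm (Fin n)) : Finset ℕ :=
  (Finset.Icc 1 n).filter (fun t => posOf (w0 n) t < posOf x t)

/-- `D_R(x)`: the coefficient of `q^{N-1}` in `wt_R(x)`, where `N = n(n-1)/2`. -/
noncomputable def D (n : ℕ) (R : List ℕ) (x : Equiv.Perm (Fin n)) : ℤ :=
  (wt n R x).coeff (n * (n - 1) / 2 - 1)

/-- `σ_b(x) = sign(pos_x(b) − pos_{w₀}(b)) ∈ {−1,0,+1}`. -/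
noncomputable def sigmaVal (n : ℕ) (b : ℕ) (x : Equiv.Perm (Fin n)) : ℤ :=
  Int.sign ((posOf x b : ℤ) - (posOf (w0 n) b : ℤ))

/-- `Θ_R(a,b,c) = Σ_{x : Supp(x) = [a,c]} D_R(x)·σ_b(x)`. -/
noncomputable def Theta (n : ℕ) (R : List ℕ) (a b c : ℕ) : ℤ :=
  ∑ x ∈ Finset.univ.filter (fun x : Equiv.Perm (Fin n) => Supp n x = Finset.Icc a c),
    D n R x * sigmaVal n b x

end BSDist

namespace BSDist

/-- One-indexed adjacent swap on positions. -/
def sw (j r : ℕ) : ℕ := if r = j then j + 1 else if r = j + 1 then j else r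

theorem sTr_val (n j : ℕ) (hj : 1 ≤ j ∧ j < n) (r : ℕ) (hr : 1 ≤ r ∧ r ≤ n)
    (hr' : r - 1 < n) : ((sTr n j ⟨r - 1, hr'⟩ : Fin n) : ℕ) + 1 = sw j r := by
  unfold sTr sw
  rw [dif_pos hj, Equiv.swap_apply_def]
  simp only [Fin.mk.injEq]
  split_ifs <;> simp <;> omega

theorem app_mul_s {n : ℕ} (w : Equiv.Perm (Fin n)) (j : ℕ) (hj : 1 ≤ j ∧ j < n) (r : ℕ) :
    app (w * sTr n j) r = app w (sw j r) := by
  by_cases hr : 1 ≤ r ∧ r ≤ n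
  · have h1 : 1 ≤ sw j r ∧ sw j r ≤ n := by unfold sw; split_ifs <;> omega
    unfold app
    rw [dif_pos hr, dif_pos h1]
    have := sTr_val n j hj r hr (by omega)
    have h2 : sTr n j ⟨r - 1, by omega⟩ = ⟨sw j r - 1, by omega⟩ := by
      apply Fin.ext
      simp only
      omega
    rw [Equiv.Perm.mul_apply, h2]
  · have h1 : sw j r = r := by unfold sw; split_ifs <;> omega
    rw [h1]; unfold app; rw [dif_neg hr, dif_neg hr]

theorem sTr_sq (n j : ℕ) : sTr n j * sTr n j = 1 := by
  unfold sTr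
  split_ifs <;> simp

theorem len_swap {n : ℕ} (w : Equiv.Perm (Fin n)) (p q : Fin n) (hpq : (q : ℕ) = p + 1)
    (h : w p < w q) : len (w * Equiv.swap p q) = len w + 1 := by
  unfold len
  have hinj : Function.Injective
      (fun x : Fin n × Fin n => (Equiv.swap p q x.1, Equiv.swap p q x.2)) := by
    rintro ⟨a, b⟩ ⟨c, d⟩ hh
    simpa using hh
  have key : (Finset.univ.filter (fun x : Fin n × Fin n =>
      x.1 < x.2 ∧ (w * Equiv.swap p q) x.2 < (w * Equiv.swap p q) x.1)) =
      insert (p, q) ((Finset.univ.filter (fun x : Fin n × Fin n =>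
        x.1 < x.2 ∧ w x.2 < w x.1)).image
          (fun x : Fin n × Fin n => (Equiv.swap p q x.1, Equiv.swap p q x.2))) := by
    have mono : ∀ a b : Fin n, a < b → (a, b) ≠ (p, q) →
        Equiv.swap p q a < Equiv.swap p q b := by
      intro a b hab hne
      rw [Ne, Prod.mk.injEq] at hne
      rw [Equiv.swap_apply_def, Equiv.swap_apply_def]
      simp only [Fin.ext_iff, Fin.lt_def] at *
      split_ifs <;> omega
    ext ⟨a, b⟩
    simp only [Finset.mem_filter, Finset.mem_univ, true_and, Finset.mem_insert,
      Finset.mem_image]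
    rw [Equiv.Perm.mul_apply, Equiv.Perm.mul_apply]
    constructor
    · rintro ⟨h1, h2⟩
      by_cases he : (a, b) = (p, q)
      · left; exact he
      · right
        exact ⟨(Equiv.swap p q a, Equiv.swap p q b), ⟨mono a b h1 he, h2⟩, by simp⟩
    · rintro (he | ⟨⟨c, d⟩, ⟨h1, h2⟩, h3⟩)
      · rw [Prod.mk.injEq] at he
        obtain ⟨rfl, rfl⟩ := he
        refine ⟨?_, by simpa using h⟩
        rw [Fin.lt_def]; omega
      · rw [Prod.mk.injEq] at h3
        obtain ⟨rfl, rfl⟩ := h3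
        refine ⟨mono c d h1 ?_, by simpa using h2⟩
        intro he
        rw [Prod.mk.injEq] at he
        obtain ⟨rfl, rfl⟩ := he
        exact absurd h (not_lt.mpr h2.le)
  rw [key, Finset.card_insert_of_notMem, Finset.card_image_of_injective _ hinj]
  simp only [Finset.mem_image, Finset.mem_filter, Finset.mem_univ, true_and, not_exists]
  rintro ⟨c, d⟩ ⟨⟨h1, h2⟩, h3⟩
  rw [Prod.mk.injEq] at h3
  have hc : c = q := by
    have := congrArg (Equiv.swap p q) h3.1
    simpa using this
  have hd : d = p := by
    have := congrArg (Equiv.swap p q) h3.2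
    simpa using this
  subst hc hd
  simp only [Fin.lt_def] at h1
  omega

theorem len_asc {n : ℕ} (w : Equiv.Perm (Fin n)) (j : ℕ) (hj : 1 ≤ j ∧ j < n)
    (h : app w j < app w (j + 1)) : len (w * sTr n j) = len w + 1 := by
  unfold sTr
  rw [dif_pos hj]
  apply len_swap
  · simp only; omega
  · unfold app at h
    rw [dif_pos (by omega), dif_pos (by omega)] at h
    rw [Fin.lt_def]
    simpa using h

theorem app_inj {n : ℕ} (w : Equiv.Perm (Fin n)) (r s : ℕ) (hr : 1 ≤ r ∧ r ≤ n)
    (hs : 1 ≤ s ∧ s ≤ n) (h : app w r = app w s) : r = s := by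
  unfold app at h
  rw [dif_pos hr, dif_pos hs] at h
  have h2 : w ⟨r - 1, by omega⟩ = w ⟨s - 1, by omega⟩ := by
    apply Fin.ext; omega
  have := congrArg Fin.val (w.injective h2)
  simp only at this
  omega

theorem len_desc {n : ℕ} (w : Equiv.Perm (Fin n)) (j : ℕ) (hj : 1 ≤ j ∧ j < n)
    (h : ¬ app w j < app w (j + 1)) : len w = len (w * sTr n j) + 1 := by
  have hne : app w j ≠ app w (j + 1) := by
    intro he
    have := app_inj w j (j + 1) (by omega) (by omega) he
    omega
  have := len_asc (w * sTr n j) j hj (by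
    rw [app_mul_s _ _ hj, app_mul_s _ _ hj]
    simp only [sw]
    simp
    omega)
  rwa [mul_assoc, sTr_sq, mul_one] at this

theorem len_iff {n : ℕ} (w : Equiv.Perm (Fin n)) (j : ℕ) (hj : 1 ≤ j ∧ j < n) :
    len w < len (w * sTr n j) ↔ app w j < app w (j + 1) := by
  by_cases h : app w j < app w (j + 1)
  · have := len_asc w j hj h
    simp only [h, iff_true]; omega
  · have := len_desc w j hj h
    simp only [h, iff_false]; omega

/-- Every letter of the word is an ascent when applied from `x`. -/
def AscW (n : ℕ) : Equiv.Perm (Fin n) → List ℕ → Prop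
  | _, [] => True
  | x, j :: B => (1 ≤ j ∧ j < n) ∧ app x j < app x (j + 1) ∧ AscW n (x * sTr n j) B

theorem wprod_cons (n j : ℕ) (B : List ℕ) : wprod n (j :: B) = sTr n j * wprod n B := by
  simp [wprod]

theorem wprod_nil (n : ℕ) : wprod n [] = 1 := by simp [wprod]

theorem wprod_append (n : ℕ) (A B : List ℕ) : wprod n (A ++ B) = wprod n A * wprod n B := by
  simp [wprod]

theorem len_le {n : ℕ} (R : List ℕ) : ∀ (x : Equiv.Perm (Fin n)), Alphabet n R →
    len (x * wprod n R) ≤ len x + R.length := by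
  induction R with
  | nil => intro x _; simp [wprod_nil]
  | cons j B ih =>
    intro x hR
    have hj : 1 ≤ j ∧ j < n := hR j (by simp)
    have h1 := ih (x * sTr n j) (fun i hi => hR i (by simp [hi]))
    rw [wprod_cons, ← mul_assoc, List.length_cons]
    by_cases h : app x j < app x (j + 1)
    · have := len_asc x j hj h; omega
    · have := len_desc x j hj h; omega

theorem ascW_of_len {n : ℕ} (R : List ℕ) : ∀ (x : Equiv.Perm (Fin n)), Alphabet n R →
    len (x * wprod n R) = len x + R.length → AscW n x R := by
  induction R with
  | nil => intro x _ _; trivial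
  | cons j B ih =>
    intro x hR hl
    have hj : 1 ≤ j ∧ j < n := hR j (by simp)
    have hB : Alphabet n B := fun i hi => hR i (by simp [hi])
    have h1 := len_le B (x * sTr n j) hB
    rw [wprod_cons, ← mul_assoc, List.length_cons] at hl
    by_cases h : app x j < app x (j + 1)
    · have := len_asc x j hj h
      exact ⟨hj, h, ih _ hB (by omega)⟩
    · have := len_desc x j hj h; omega

theorem ascW_append {n : ℕ} (A B : List ℕ) : ∀ (x : Equiv.Perm (Fin n)),
    AscW n x (A ++ B) ↔ AscW n x A ∧ AscW n (x * wprod n A) B := by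
  induction A with
  | nil => intro x; simp [wprod_nil, AscW]
  | cons j A ih =>
    intro x
    simp only [List.cons_append, AscW, ih, wprod_cons, mul_assoc, and_assoc]

theorem len_one (n : ℕ) : len (1 : Equiv.Perm (Fin n)) = 0 := by
  unfold len
  rw [Finset.card_eq_zero, Finset.filter_eq_empty_iff]
  rintro ⟨a, b⟩ _ ⟨h1, h2⟩
  simp only [Equiv.Perm.one_apply] at h2
  exact absurd h1 (not_lt.mpr h2.le)

/-- Demazure product starting from `x`. -/
def demF (n : ℕ) (x : Equiv.Perm (Fin n)) (R : List ℕ) : Equiv.Perm (Fin n) :=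
  R.foldl (fun w i => if len w < len (w * sTr n i) then w * sTr n i else w) x

theorem demF_asc {n : ℕ} (R : List ℕ) : ∀ (x : Equiv.Perm (Fin n)), AscW n x R →
    demF n x R = x * wprod n R := by
  induction R with
  | nil => intro x _; simp [demF, wprod_nil]
  | cons j B ih =>
    rintro x ⟨hj, h, hB⟩
    have := ih _ hB
    unfold demF at this ⊢
    rw [List.foldl_cons, if_pos ((len_iff x j hj).mpr h), this, wprod_cons, mul_assoc]

/-- Equal thresholded states. -/
def Eqv (m : ℕ) (X Y : ℕ → ℕ) : Prop := ∀ r, m < X r ↔ m < Y r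

/-- The thresholded states differ by a pair of discrepancies at `p < q`. -/
def Inv (m : ℕ) (X Y : ℕ → ℕ) (p q : ℕ) (α β : Prop) : Prop :=
  p < q ∧ m < X p ∧ X q ≤ m ∧ Y p ≤ m ∧ m < Y q ∧
  (∀ r, r ≠ p → r ≠ q → (m < X r ↔ m < Y r)) ∧
  (α → ∃ r, r ≤ p ∧ X r = m + 1) ∧ (β → ∃ r, q ≤ r ∧ X r = m)

/-- Demazure step on sequences. -/
def stp (j : ℕ) (Y : ℕ → ℕ) : ℕ → ℕ := fun r => if Y j < Y (j + 1) then Y (sw j r) else Y r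

theorem eqv_step (m j : ℕ) (X Y : ℕ → ℕ) (hX : X j < X (j + 1)) (h : Eqv m X Y) :
    Eqv m (fun r => X (sw j r)) (stp j Y) := by
  intro r
  have h1 := h j
  have h2 := h (j + 1)
  have h3 := h r
  simp only [stp, sw]
  split_ifs <;> subst_vars <;> omega

theorem ex_le_step (X : ℕ → ℕ) (j p p' k : ℕ)
    (h : ∀ r, r ≤ p → X r = k → sw j r ≤ p')
    (hh : ∃ r, r ≤ p ∧ X r = k) : ∃ r, r ≤ p' ∧ X (sw j r) = k := by
  obtain ⟨r, hr, hx⟩ := hh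
  refine ⟨sw j r, h r hr hx, ?_⟩
  have : sw j (sw j r) = r := by unfold sw; split_ifs <;> omega
  rw [this, hx]

theorem ex_ge_step (X : ℕ → ℕ) (j p p' k : ℕ)
    (h : ∀ r, p ≤ r → X r = k → p' ≤ sw j r)
    (hh : ∃ r, p ≤ r ∧ X r = k) : ∃ r, p' ≤ r ∧ X (sw j r) = k := by
  obtain ⟨r, hr, hx⟩ := hh
  refine ⟨sw j r, h r hr hx, ?_⟩
  have : sw j (sw j r) = r := by unfold sw; split_ifs <;> omega
  rw [this, hx]

theorem inv_step (m j : ℕ) (X Y : ℕ → ℕ) (p q : ℕ) (α β : Prop) (hX : X j < X (j + 1))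
    (h : Inv m X Y p q α β) :
    ∃ p' q', Inv m (fun r => X (sw j r)) (stp j Y) p' q' α β := by
  obtain ⟨hpq, hXp, hXq, hYp, hYq, hr, hα, hβ⟩ := h
  let p' := if j = p then p + 1 else if j + 1 = p ∧ X j ≤ m then j else p
  let q' := if j + 1 = q then j else if j = q ∧ m < X (j + 1) then j + 1 else q
  have hne : ¬ (j = p ∧ j + 1 = q) := by rintro ⟨rfl, rfl⟩; omega
  have hj1 : j = p → m < X (j + 1) := by rintro rfl; omega
  have hj2 : j + 1 = q → X j ≤ m := by rintro rfl; omega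
  have hrj := hr j
  have hrj1 := hr (j + 1)
  have ep : ∀ r, r = p → m < X r ∧ Y r ≤ m := by rintro r rfl; exact ⟨hXp, hYp⟩
  have eq' : ∀ r, r = q → X r ≤ m ∧ m < Y r := by rintro r rfl; exact ⟨hXq, hYq⟩
  have epj := ep j
  have epj1 := ep (j + 1)
  have eqj := eq' j
  have eqj1 := eq' (j + 1)
  have hp' : p' = if j = p then p + 1 else if j + 1 = p ∧ X j ≤ m then j else p := rfl
  have hq' : q' = if j + 1 = q then j else if j = q ∧ m < X (j + 1) then j + 1 else q := rfl
  have full : ∀ r, ((r = p' → m < X (sw j r) ∧ stp j Y r ≤ m) ∧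
      (r = q' → X (sw j r) ≤ m ∧ m < stp j Y r) ∧
      (r ≠ p' → r ≠ q' → (m < X (sw j r) ↔ m < stp j Y r))) := by
    intro r
    have hrr := hr r
    have epr := ep r
    have eqr := eq' r
    clear_value p' q'
    clear hr hα hβ ep eq'
    by_cases h1 : r = j
    · subst h1
      have : sw r r = r + 1 := by simp [sw]
      simp only [stp, this]
      split_ifs at * <;> omega
    · by_cases h2 : r = j + 1
      · subst h2
        have : sw j (j + 1) = j := by simp [sw]
        simp only [stp, this]
        split_ifs at * <;> omega
      · have : sw j r = r := by simp [sw, h1, h2]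
        simp only [stp, this, ite_self]
        split_ifs at * <;> omega
  refine ⟨p', q', ?_, (full p').1 rfl |>.1, (full q').2.1 rfl |>.1, (full p').1 rfl |>.2,
    (full q').2.1 rfl |>.2, fun r => (full r).2.2, ?_, ?_⟩
  · clear full; clear_value p' q'
    split_ifs at * <;> omega
  · intro ha
    refine ex_le_step X j p p' _ ?_ (hα ha)
    intro r hrp hx
    clear full; clear_value p' q'
    have e1 : r = j → X j = m + 1 := by rintro rfl; exact hx
    have e2 : r = j + 1 → X (j + 1) = m + 1 := by rintro rfl; exact hx
    unfold sw
    split_ifs at * <;> omega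
  · intro hb
    refine ex_ge_step X j q q' _ ?_ (hβ hb)
    intro r hrp hx
    clear full; clear_value p' q'
    have e1 : r = j → X j = m := by rintro rfl; exact hx
    have e2 : r = j + 1 → X (j + 1) = m := by rintro rfl; exact hx
    unfold sw
    split_ifs at * <;> omega

theorem app_demstep {n : ℕ} (Y : Equiv.Perm (Fin n)) (j : ℕ) (hj : 1 ≤ j ∧ j < n) :
    app (if len Y < len (Y * sTr n j) then Y * sTr n j else Y) = stp j (app Y) := by
  funext r
  unfold stp
  by_cases h : app Y j < app Y (j + 1)
  · rw [if_pos ((len_iff Y j hj).mpr h), if_pos h, app_mul_s _ _ hj]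
  · rw [if_neg (fun h' => h ((len_iff Y j hj).mp h')), if_neg h]

theorem eqv_run {n : ℕ} (m : ℕ) (R : List ℕ) : ∀ (X Y : Equiv.Perm (Fin n)), AscW n X R →
    Eqv m (app X) (app Y) → Eqv m (app (X * wprod n R)) (app (demF n Y R)) := by
  induction R with
  | nil => intro X Y _ h; simpa [wprod_nil, demF] using h
  | cons j B ih =>
    rintro X Y ⟨hj, h, hB⟩ he
    have h1 := eqv_step m j _ _ h he
    rw [← app_demstep Y j hj, show (fun r => app X (sw j r)) = app (X * sTr n j) from
      funext fun r => (app_mul_s X j hj r).symm] at h1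
    have := ih _ _ hB h1
    rw [wprod_cons, ← mul_assoc]
    exact this

theorem inv_run {n : ℕ} (m : ℕ) (α β : Prop) (R : List ℕ) : ∀ (X Y : Equiv.Perm (Fin n)),
    AscW n X R → (∃ p q, Inv m (app X) (app Y) p q α β) →
    ∃ p q, Inv m (app (X * wprod n R)) (app (demF n Y R)) p q α β := by
  induction R with
  | nil => intro X Y _ h; simpa [wprod_nil, demF] using h
  | cons j B ih =>
    rintro X Y ⟨hj, h, hB⟩ ⟨p, q, he⟩
    have h1 := inv_step m j _ _ p q α β h he
    rw [← app_demstep Y j hj, show (fun r => app X (sw j r)) = app (X * sTr n j) from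
      funext fun r => (app_mul_s X j hj r).symm] at h1
    have := ih _ _ hB h1
    rw [wprod_cons, ← mul_assoc]
    exact this

theorem app_w0 (n r : ℕ) : app (w0 n) r = if 1 ≤ r ∧ r ≤ n then n + 1 - r else 0 := by
  unfold app
  split_ifs with h
  · simp [w0, Fin.val_rev]; omega
  · rfl

theorem app_range {n : ℕ} (w : Equiv.Perm (Fin n)) (r : ℕ) (h : 0 < app w r) :
    1 ≤ r ∧ r ≤ n := by
  by_contra hc
  unfold app at h
  rw [dif_neg hc] at h
  omega

theorem app_mem {n : ℕ} (w : Equiv.Perm (Fin n)) (r : ℕ) (h : 1 ≤ r ∧ r ≤ n) :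
    1 ≤ app w r ∧ app w r ≤ n := by
  unfold app
  rw [dif_pos h]
  have := (w ⟨r - 1, by omega⟩).isLt
  omega

theorem posOf_eq {n : ℕ} (w : Equiv.Perm (Fin n)) (r t : ℕ) (hr : 1 ≤ r ∧ r ≤ n)
    (h : app w r = t) : posOf w t = r := by
  have h1 := app_mem w r hr
  rw [h] at h1
  unfold posOf
  unfold app at h ⊢
  rw [dif_pos hr] at h
  rw [dif_pos h1]
  have : (⟨t - 1, by omega⟩ : Fin n) = w ⟨r - 1, by omega⟩ := by
    apply Fin.ext; simp only; omega
  rw [this]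
  simp; omega

theorem app_posOf {n : ℕ} (w : Equiv.Perm (Fin n)) (t : ℕ) (ht : 1 ≤ t ∧ t ≤ n) :
    app w (posOf w t) = t := by
  have := posOf_eq w⁻¹ t (posOf w t) ht rfl
  unfold posOf at this ⊢
  rwa [inv_inv] at this

theorem posOf_w0 (n t : ℕ) (ht : 1 ≤ t ∧ t ≤ n) : posOf (w0 n) t = n + 1 - t := by
  apply posOf_eq
  · omega
  · rw [app_w0]; split_ifs <;> omega

theorem core {n : ℕ} (X Y v : Equiv.Perm (Fin n)) (R : List ℕ) (hR : AscW n X R)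
    (hw : X * wprod n R = w0 n) (hv : v = demF n Y R) (a c : ℕ) (hac : a < c)
    (ha1 : 1 ≤ a) (hcn : c ≤ n)
    (A : ℕ → Prop) (hAa : A a) (hAc : ¬ A c)
    (h1 : ∀ m, m < a ∨ c ≤ m → Eqv m (app X) (app Y))
    (h2 : ∀ m, a ≤ m → m < c →
      ∃ p q, Inv m (app X) (app Y) p q (A (m + 1) ∧ m + 1 < c) (¬ A m ∧ a < m)) :
    ∀ t, 1 ≤ t ∧ t ≤ n →
      ((t < a ∨ c < t) → posOf v t = posOf (w0 n) t) ∧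
      (a ≤ t → t ≤ c → A t → posOf v t < posOf (w0 n) t) ∧
      (a ≤ t → t ≤ c → ¬ A t → posOf (w0 n) t < posOf v t) := by
  have e1 : ∀ m, m < a ∨ c ≤ m → Eqv m (app (w0 n)) (app v) := by
    intro m hm
    rw [← hw, hv]
    exact eqv_run m R X Y hR (h1 m hm)
  have e2 : ∀ m, a ≤ m → m < c →
      ∃ p q, Inv m (app (w0 n)) (app v) p q (A (m + 1) ∧ m + 1 < c) (¬ A m ∧ a < m) := by
    intro m hm hm'
    rw [← hw, hv]
    exact inv_run m _ _ R X Y hR (h2 m hm hm')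
  have e3 : ∀ m, a ≤ m → m < c → ∃ p q, 1 ≤ p ∧ p + m ≤ n ∧ n < q + m ∧ q ≤ n ∧
      app v p ≤ m ∧ m < app v q ∧
      (∀ r, r ≠ p → r ≠ q → 1 ≤ r → r ≤ n → (m < n + 1 - r ↔ m < app v r)) ∧
      (A (m + 1) ∧ m + 1 < c → p + m = n) ∧ (¬ A m ∧ a < m → q + m = n + 1) := by
    intro m hm hm'
    obtain ⟨p, q, hpq, hXp, hXq, hYp, hYq, hr, hα, hβ⟩ := e2 m hm hm'
    have hp := app_range (w0 n) p (by omega)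
    have hq := app_range v q (by omega)
    rw [app_w0, if_pos hp] at hXp
    rw [app_w0, if_pos hq] at hXq
    have hp2 : p + m ≤ n := by clear hα hβ; omega
    have hq2 : n < q + m := by clear hα hβ; omega
    refine ⟨p, q, hp.1, hp2, hq2, hq.2, hYp, hYq, ?_, ?_, ?_⟩
    · intro r hr1 hr2 hr3 hr4
      have := hr r hr1 hr2
      rwa [app_w0, if_pos ⟨hr3, hr4⟩] at this
    · intro h
      obtain ⟨r, hr1, hr2⟩ := hα h
      clear hα hβ
      rw [app_w0] at hr2
      split_ifs at hr2
      omega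
    · intro h
      obtain ⟨r, hr1, hr2⟩ := hβ h
      clear hα hβ
      rw [app_w0] at hr2
      split_ifs at hr2 <;> omega
  have e4 : ∀ m, m < a ∨ c ≤ m → ∀ r, 1 ≤ r → r ≤ n → (m < n + 1 - r ↔ m < app v r) := by
    intro m hm r hr hr'
    have := e1 m hm r
    rwa [app_w0, if_pos ⟨hr, hr'⟩] at this
  intro t ht
  rw [posOf_w0 n t ht]
  refine ⟨?_, ?_, ?_⟩
  · intro htt
    apply posOf_eq
    · omega
    · have g1 := e4 t (by omega) (n + 1 - t) (by omega) (by omega)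
      have g2 := e4 (t - 1) (by omega) (n + 1 - t) (by omega) (by omega)
      omega
  · intro hat htc hA
    have htc' : t < c := by
      rcases Nat.lt_or_ge t c with h | h
      · exact h
      · exact absurd (by rwa [show t = c by omega] at hA) hAc
    obtain ⟨p, q, k1, k2, k3, k4, k5, k6, k7, k8, k9⟩ := e3 t hat htc'
    have hpos : app v p = t := by
      rcases Nat.eq_or_lt_of_le hat with h | h
      · have := e4 (t - 1) (by omega) p (by omega) (by omega)
        omega
      · obtain ⟨p2, q2, l1, l2, l3, l4, l5, l6, l7, l8, l9⟩ := e3 (t - 1) (by omega) (by omega)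
        rw [show t - 1 + 1 = t by omega] at l8
        have l8' := l8 ⟨hA, htc'⟩
        have := l7 p (by omega) (by omega) (by omega) (by omega)
        omega
    rw [posOf_eq v p t (by omega) hpos]
    omega
  · intro hat htc hA
    have hat' : a < t := by
      rcases Nat.eq_or_lt_of_le hat with h | h
      · exact absurd (by rwa [h] at hAa) hA
      · exact h
    obtain ⟨p, q, k1, k2, k3, k4, k5, k6, k7, k8, k9⟩ := e3 (t - 1) (by omega) (by omega)
    have hpos : app v q = t := by
      rcases Nat.eq_or_lt_of_le htc with h | h
      · have := e4 t (by omega) q (by omega) (by omega)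
        omega
      · obtain ⟨p2, q2, l1, l2, l3, l4, l5, l6, l7, l8, l9⟩ := e3 t (by omega) (by omega)
        have l9' := l9 ⟨hA, hat'⟩
        have := l7 q (by omega) (by omega) (by omega) (by omega)
        omega
    rw [posOf_eq v q t (by omega) hpos]
    omega

theorem sets_of_core {n : ℕ} (v u : Equiv.Perm (Fin n)) (a c K : ℕ)
    (ha1 : 1 ≤ a) (hcn : c ≤ n)
    (H : ∀ t, 1 ≤ t ∧ t ≤ n →
      ((t < a ∨ c < t) → posOf v t = posOf (w0 n) t) ∧
      (a ≤ t → t ≤ c → posOf u t ≤ K → posOf v t < posOf (w0 n) t) ∧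
      (a ≤ t → t ≤ c → ¬ posOf u t ≤ K → posOf (w0 n) t < posOf v t)) :
    Supp n v = Finset.Icc a c ∧
    Fwd n v = (Finset.Icc 1 n).filter (fun t => a ≤ t ∧ t ≤ c ∧ posOf u t ≤ K) ∧
    Bwd n v = (Finset.Icc 1 n).filter (fun t => a ≤ t ∧ t ≤ c ∧ K + 1 ≤ posOf u t) := by
  refine ⟨?_, ?_, ?_⟩
  · ext t
    simp only [Supp, Finset.mem_filter, Finset.mem_Icc]
    have := H t
    omega
  · ext t
    simp only [Fwd, Finset.mem_filter, Finset.mem_Icc]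
    have := H t
    omega
  · ext t
    simp only [Bwd, Finset.mem_filter, Finset.mem_Icc]
    have := H t
    omega

set_option maxHeartbeats 2000000 in
/-- Suppose `R₁ = T₁·i(i+1)i·T₂` and
`R₂ = T₁·(i+1)i(i+1)·T₂` are both reduced words for `w₀ ∈ S_n`.  With
`u = w(T₁)`, `a = u(i)`, `b = u(i+1)`, `c = u(i+2)`,
`v₁ = Dem(T₁·i·T₂)`, `v₂ = Dem(T₁·(i+1)·T₂)`, one has `a < b < c`,
`Supp(v₁) = Supp(v₂) = [a,c]`, and the forward/backward sets are as
described, with the stated inclusions. -/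
theorem supp_fwd_bwd_of_braid_shortenings
    (n : ℕ) (hn : 2 ≤ n) (T₁ T₂ : List ℕ) (i : ℕ)
    (hi : 1 ≤ i ∧ i ≤ n - 2)
    (hred₁ : IsReducedWordFor n (T₁ ++ [i, i + 1, i] ++ T₂) (w0 n))
    (hred₂ : IsReducedWordFor n (T₁ ++ [i + 1, i, i + 1] ++ T₂) (w0 n))
    (u : Equiv.Perm (Fin n)) (hu : u = wprod n T₁)
    (a b c : ℕ) (ha : a = app u i) (hb : b = app u (i + 1)) (hc : c = app u (i + 2))
    (v₁ v₂ : Equiv.Perm (Fin n))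
    (hv₁ : v₁ = dem n (T₁ ++ [i] ++ T₂))
    (hv₂ : v₂ = dem n (T₁ ++ [i + 1] ++ T₂)) :
    a < b ∧ b < c ∧
    Supp n v₁ = Finset.Icc a c ∧ Supp n v₂ = Finset.Icc a c ∧
    Fwd n v₁ = (Finset.Icc 1 n).filter (fun t => a ≤ t ∧ t ≤ c ∧ posOf u t ≤ i + 1) ∧
    {a, b} ⊆ Fwd n v₁ ∧
    Bwd n v₁ = (Finset.Icc 1 n).filter (fun t => a ≤ t ∧ t ≤ c ∧ i + 2 ≤ posOf u t) ∧
    c ∈ Bwd n v₁ ∧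
    Fwd n v₂ = (Finset.Icc 1 n).filter (fun t => a ≤ t ∧ t ≤ c ∧ posOf u t ≤ i) ∧
    a ∈ Fwd n v₂ ∧
    Bwd n v₂ = (Finset.Icc 1 n).filter (fun t => a ≤ t ∧ t ≤ c ∧ i + 1 ≤ posOf u t) ∧
    {b, c} ⊆ Bwd n v₂ := by
  subst hu
  have hi1 : 1 ≤ i ∧ i < n := by omega
  have hi2 : 1 ≤ i + 1 ∧ i + 1 < n := by omega
  have hasc : AscW n 1 (T₁ ++ [i, i + 1, i] ++ T₂) := by
    apply ascW_of_len _ _ hred₁.1.1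
    rw [one_mul, len_one, zero_add]
    exact hred₁.1.2.symm
  have hw := hred₁.2
  rw [wprod_append, wprod_append] at hw
  rw [ascW_append, ascW_append, wprod_append, one_mul, one_mul] at hasc
  obtain ⟨⟨hT1, hmid⟩, hT2⟩ := hasc
  have hd1 : demF n 1 T₁ = wprod n T₁ := by rw [demF_asc _ _ hT1, one_mul]
  generalize wprod n T₁ = u at *
  simp only [AscW] at hmid
  obtain ⟨-, m1, -, m2, -, m3, -⟩ := hmid
  have hd : ∀ k, dem n (T₁ ++ [k] ++ T₂) = demF n (demF n u [k]) T₂ := by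
    intro k
    rw [← hd1]
    simp only [dem, demF, List.foldl_append]
  rw [app_mul_s _ _ hi2, app_mul_s _ _ hi2, app_mul_s _ _ hi1, app_mul_s _ _ hi1] at m3
  rw [app_mul_s _ _ hi1, app_mul_s _ _ hi1] at m2
  have s1 : sw i (i + 1) = i := by simp [sw]
  have s2 : sw i (i + 1 + 1) = i + 2 := by unfold sw; split_ifs <;> omega
  have s3 : sw (i + 1) i = i := by unfold sw; split_ifs <;> omega
  have s4 : sw i i = i + 1 := by simp [sw]
  have s5 : sw (i + 1) (i + 1) = i + 2 := by simp [sw]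
  have s6 : sw i (i + 2) = i + 2 := by unfold sw; split_ifs <;> omega
  rw [s1, s2, ← ha, ← hc] at m2
  rw [s3, s4, s5, s6, ← hb, ← hc] at m3
  rw [← ha, ← hb] at m1
  have hv₁' : v₁ = demF n (u * sTr n i) T₂ := by
    rw [hv₁, hd]
    congr 1
    simp only [demF, List.foldl_cons, List.foldl_nil]
    rw [if_pos]
    rw [len_iff u i hi1, ← ha, ← hb]; exact m1
  have hv₂' : v₂ = demF n (u * sTr n (i + 1)) T₂ := by
    rw [hv₂, hd]
    congr 1
    simp only [demF, List.foldl_cons, List.foldl_nil]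
    rw [if_pos]
    rw [len_iff u (i + 1) hi2, ← hb, show i + 1 + 1 = i + 2 from rfl, ← hc]; exact m3
  have hra := app_mem u i (by omega)
  have hrb := app_mem u (i + 1) (by omega)
  have hrc := app_mem u (i + 2) (by omega)
  have pa : posOf u a = i := posOf_eq u i a (by omega) ha.symm
  have pb : posOf u b = i + 1 := posOf_eq u (i + 1) b (by omega) hb.symm
  have pc : posOf u c = i + 2 := posOf_eq u (i + 2) c (by omega) hc.symm
  rw [← ha] at hra
  rw [← hb] at hrb
  rw [← hc] at hrc
  generalize hX : u * wprod n [i, i + 1, i] = X at *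
  have aX : ∀ r, app X r = if r = i then c else if r = i + 1 then b else
      if r = i + 2 then a else app u r := by
    intro r
    rw [← hX, wprod_cons, wprod_cons, wprod_cons, wprod_nil, mul_one, ← mul_assoc, ← mul_assoc,
      app_mul_s _ _ hi1, app_mul_s _ _ hi2, app_mul_s _ _ hi1]
    split_ifs with h1 h2 h3
    · rw [h1, s4, s5, s6, hc]
    · rw [h2, s1, s3, s4, hb]
    · rw [h3, s6, show sw (i + 1) (i + 2) = i + 1 by simp [sw], s1, ha]
    · congr 1
      unfold sw; split_ifs <;> omega
  have aY : ∀ r, app (u * sTr n i) r = if r = i then b else if r = i + 1 then a else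
      if r = i + 2 then c else app u r := by
    intro r
    rw [app_mul_s _ _ hi1]
    split_ifs with h1 h2 h3
    · rw [h1, s4, hb]
    · rw [h2, s1, ha]
    · rw [h3, s6, hc]
    · congr 1
      unfold sw; split_ifs <;> omega
  have aZ : ∀ r, app (u * sTr n (i + 1)) r = if r = i then a else if r = i + 1 then c else
      if r = i + 2 then b else app u r := by
    intro r
    rw [app_mul_s _ _ hi2]
    split_ifs with h1 h2 h3
    · rw [h1, s3, ha]
    · rw [h2, s5, hc]
    · rw [h3, show sw (i + 1) (i + 2) = i + 1 by simp [sw], hb]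
    · congr 1
      unfold sw; split_ifs <;> omega
  have pne : ∀ t k, 1 ≤ t ∧ t ≤ n → posOf u t = k → app u k = t := by
    intro t k ht hk
    rw [← hk]; exact app_posOf u t ht
  have low : ∀ t, 1 ≤ t ∧ t ≤ n → posOf u t < i → app X (posOf u t) = t := by
    intro t ht h
    rw [aX, if_neg (by omega), if_neg (by omega), if_neg (by omega)]
    exact app_posOf u t ht
  have high : ∀ t, 1 ≤ t ∧ t ≤ n → i + 2 < posOf u t → app X (posOf u t) = t := by
    intro t ht h
    rw [aX, if_neg (by omega), if_neg (by omega), if_neg (by omega)]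
    exact app_posOf u t ht
  have Xi : app X i = c := by rw [aX, if_pos rfl]
  have Xi1 : app X (i + 1) = b := by rw [aX, if_neg (by omega), if_pos rfl]
  have Xi2 : app X (i + 2) = a := by
    rw [aX, if_neg (by omega), if_neg (by omega), if_pos rfl]
  have Yi : app (u * sTr n i) i = b := by rw [aY, if_pos rfl]
  have Yi1 : app (u * sTr n i) (i + 1) = a := by rw [aY, if_neg (by omega), if_pos rfl]
  have Yi2 : app (u * sTr n i) (i + 2) = c := by
    rw [aY, if_neg (by omega), if_neg (by omega), if_pos rfl]
  have Zi : app (u * sTr n (i + 1)) i = a := by rw [aZ, if_pos rfl]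
  have Zi1 : app (u * sTr n (i + 1)) (i + 1) = c := by rw [aZ, if_neg (by omega), if_pos rfl]
  have Zi2 : app (u * sTr n (i + 1)) (i + 2) = b := by
    rw [aZ, if_neg (by omega), if_neg (by omega), if_pos rfl]
  have core1 := core X (u * sTr n i) v₁ T₂ hT2 hw hv₁' a c m2 hra.1 hrc.2
    (fun t => posOf u t ≤ i + 1) (by omega) (by omega)
    (by
      intro m hm r
      rw [aX, aY]
      split_ifs <;> omega)
    (by
      intro m hm hm'
      have hαl : ∀ p, i ≤ p → (m < b → i + 1 ≤ p) → posOf u (m + 1) ≤ i + 1 ∧ m + 1 < c →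
          ∃ r, r ≤ p ∧ app X r = m + 1 := by
        intro p hp hpb h
        rcases Nat.lt_or_ge (posOf u (m + 1)) i with h1 | h1
        · exact ⟨_, by omega, low (m + 1) (by omega) h1⟩
        · have h2 : posOf u (m + 1) = i ∨ posOf u (m + 1) = i + 1 := by omega
          rcases h2 with h2 | h2
          · have := pne _ _ (by omega) h2
            omega
          · have := pne _ _ (by omega) h2
            exact ⟨i + 1, by omega, by omega⟩
      have hβl : ¬ posOf u m ≤ i + 1 ∧ a < m → ∃ r, i + 2 ≤ r ∧ app X r = m := by
        intro h
        rcases Nat.lt_or_ge (i + 2) (posOf u m) with h1 | h1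
        · exact ⟨_, by omega, high m (by omega) h1⟩
        · have := pne m (i + 2) (by omega) (by omega)
          omega
      rcases Nat.lt_or_ge m b with h | h
      · refine ⟨i + 1, i + 2, by omega, by omega, by omega, by omega, by omega, ?_,
          hαl _ (by omega) (by omega), hβl⟩
        intro r hr hr'
        rw [aX, aY]
        split_ifs <;> omega
      · refine ⟨i, i + 2, by omega, by omega, by omega, by omega, by omega, ?_,
          hαl _ (by omega) (by omega), hβl⟩
        intro r hr hr'
        rw [aX, aY]
        split_ifs <;> omega)
  have core2 := core X (u * sTr n (i + 1)) v₂ T₂ hT2 hw hv₂' a c m2 hra.1 hrc.2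
    (fun t => posOf u t ≤ i) (by omega) (by omega)
    (by
      intro m hm r
      rw [aX, aZ]
      split_ifs <;> omega)
    (by
      intro m hm hm'
      have hαl : posOf u (m + 1) ≤ i ∧ m + 1 < c →
          ∃ r, r ≤ i ∧ app X r = m + 1 := by
        intro h
        rcases Nat.lt_or_ge (posOf u (m + 1)) i with h1 | h1
        · exact ⟨_, by omega, low (m + 1) (by omega) h1⟩
        · have := pne (m + 1) i (by omega) (by omega)
          omega
      have hβl : ∀ q, q ≤ i + 2 → (b ≤ m → q ≤ i + 1) → ¬ posOf u m ≤ i ∧ a < m →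
          ∃ r, q ≤ r ∧ app X r = m := by
        intro q hq hqb h
        rcases Nat.lt_or_ge (i + 2) (posOf u m) with h1 | h1
        · exact ⟨_, by omega, high m (by omega) h1⟩
        · have h2 : posOf u m = i + 1 ∨ posOf u m = i + 2 := by omega
          rcases h2 with h2 | h2
          · have := pne _ _ (by omega) h2
            exact ⟨i + 1, by omega, by omega⟩
          · have := pne _ _ (by omega) h2
            omega
      rcases Nat.lt_or_ge m b with h | h
      · refine ⟨i, i + 2, by omega, by omega, by omega, by omega, by omega, ?_,
          hαl, hβl _ (by omega) (by omega)⟩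
        intro r hr hr'
        rw [aX, aZ]
        split_ifs <;> omega
      · refine ⟨i, i + 1, by omega, by omega, by omega, by omega, by omega, ?_,
          hαl, hβl _ (by omega) (by omega)⟩
        intro r hr hr'
        rw [aX, aZ]
        split_ifs <;> omega)
  obtain ⟨S1, F1, B1⟩ := sets_of_core v₁ u a c (i + 1) hra.1 hrc.2 core1
  obtain ⟨S2, F2, B2⟩ := sets_of_core v₂ u a c i hra.1 hrc.2 core2
  refine ⟨m1, m3, S1, S2, F1, ?_, B1, ?_, F2, ?_, B2, ?_⟩
  · rw [F1]
    intro t ht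
    rw [Finset.mem_insert, Finset.mem_singleton] at ht
    rw [Finset.mem_filter, Finset.mem_Icc]
    rcases ht with rfl | rfl <;> omega
  · rw [B1, Finset.mem_filter, Finset.mem_Icc]
    omega
  · rw [F2, Finset.mem_filter, Finset.mem_Icc]
    omega
  · rw [B2]
    intro t ht
    rw [Finset.mem_insert, Finset.mem_singleton] at ht
    rw [Finset.mem_filter, Finset.mem_Icc]
    rcases ht with rfl | rfl <;> omega

end BSDist
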